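/- There does not exist a (4,5)-net in ℂℙ². -/

import Mathlib

/-- An `(n,k)`-net in `ℂℙ²`. Points of `ℂℙ²` are the 1-dimensional `ℂ`-linear
subspaces of `ℂ³` and lines are the 2-dimensional subspaces; a point `p` lies
on a line `ℓ` iff `p ≤ ℓ`. `A` assigns to each `i : Fin n` a finite set of `k`
lines, the classes `A i` are pairwise disjoint, `χ` is a finite set of points,
lines from different classes are distinct and meet in a point of `χ`, and
through every point of `χ` there passes exactly one line of each class. -/
structure IsNet (n k : ℕ) (A : Fin n → Finset (Submodule ℂ (Fin 3 → ℂ)))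
    (χ : Finset (Submodule ℂ (Fin 3 → ℂ))) : Prop where
  three_le : 3 ≤ n
  line_dim : ∀ i, ∀ ℓ ∈ A i, Module.finrank ℂ ℓ = 2
  point_dim : ∀ p ∈ χ, Module.finrank ℂ p = 1
  card_eq : ∀ i, (A i).card = k
  classes_disjoint : ∀ i j, i ≠ j → Disjoint (A i) (A j)
  inter_mem : ∀ i j, i ≠ j → ∀ ℓ₁ ∈ A i, ∀ ℓ₂ ∈ A j, ℓ₁ ≠ ℓ₂ ∧ ℓ₁ ⊓ ℓ₂ ∈ χ
  unique_line : ∀ X ∈ χ, ∀ i, ∃! ℓ, ℓ ∈ A i ∧ X ≤ ℓ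


namespace Net45

/-- positionwise different -/
def compat : List ℕ → List ℕ → Bool
  | a :: p, b :: q => !(Nat.beq a b) && compat p q
  | _, _ => true

def notIn (a b : ℕ) : List ℕ → List ℕ → Bool
  | c :: p, d :: q => !(Nat.beq a c && Nat.beq b d) && notIn a b p q
  | _, _ => true

def orth (s t : List ℕ) : List ℕ → List ℕ → Bool
  | c :: p, d :: q => notIn c d s t && orth s t p q
  | _, _ => true

def pmul (p q : List ℕ) : List ℕ := q.map (fun j => p.getD j 0)

def leaf (r1 : List ℕ × List ℕ) (rows : List (List ℕ × List ℕ)) : Bool :=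
  let s := r1.1
  let t := r1.2
  let s2 := pmul s s
  let s3 := pmul s s2
  let s4 := pmul s s3
  pmul s s4 == [0, 1, 2, 3, 4] && (t == s2 || t == s3 || t == s4) &&
    rows.any (fun r => r.1 == s2 && r.2 == pmul t t)

def guardS (n : ℕ) (s : List ℕ) (rows : List (List ℕ × List ℕ)) : Bool :=
  Nat.beq (s.headD 0) n && rows.all (fun r => compat s r.1)

def guardT (s t : List ℕ) (rows : List (List ℕ × List ℕ)) : Bool :=
  compat s t && rows.all (fun r => compat t r.2 && orth s t r.1 r.2)

def search (D : List (List ℕ)) (F : List (List ℕ × List ℕ) → Bool) :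
    ℕ → ℕ → List (List ℕ × List ℕ) → Bool
  | 0, _, rows => F rows
  | k + 1, n, rows => D.all fun s => !(guardS n s rows) ||
      D.all fun t => !(guardT s t rows) || search D F k (n + 1) ((s, t) :: rows)

def finish : List (List ℕ × List ℕ) → Bool
  | [r4, r3, r2, r1] => leaf r1 [r2, r3, r4]
  | _ => true

def ders : List (List ℕ) := 
  [[1, 0, 3, 4, 2], [1, 0, 4, 2, 3], [1, 2, 0, 4, 3], [1, 2, 3, 4, 0],
   [1, 2, 4, 0, 3], [1, 3, 0, 4, 2], [1, 3, 4, 0, 2], [1, 3, 4, 2, 0],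
   [1, 4, 0, 2, 3], [1, 4, 3, 0, 2], [1, 4, 3, 2, 0], [2, 0, 1, 4, 3],
   [2, 0, 3, 4, 1], [2, 0, 4, 1, 3], [2, 3, 0, 4, 1], [2, 3, 1, 4, 0],
   [2, 3, 4, 0, 1], [2, 3, 4, 1, 0], [2, 4, 0, 1, 3], [2, 4, 1, 0, 3],
   [2, 4, 3, 0, 1], [2, 4, 3, 1, 0], [3, 0, 1, 4, 2], [3, 0, 4, 1, 2],
   [3, 0, 4, 2, 1], [3, 2, 0, 4, 1], [3, 2, 1, 4, 0], [3, 2, 4, 0, 1],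
   [3, 2, 4, 1, 0], [3, 4, 0, 1, 2], [3, 4, 0, 2, 1], [3, 4, 1, 0, 2],
   [3, 4, 1, 2, 0], [4, 0, 1, 2, 3], [4, 0, 3, 1, 2], [4, 0, 3, 2, 1],
   [4, 2, 0, 1, 3], [4, 2, 1, 0, 3], [4, 2, 3, 0, 1], [4, 2, 3, 1, 0],
   [4, 3, 0, 1, 2], [4, 3, 0, 2, 1], [4, 3, 1, 0, 2], [4, 3, 1, 2, 0]]

set_option maxRecDepth 100000 in
theorem search_true : search ders finish 4 1 [] = true := by
  decide +kernel

set_option synthInstance.maxSize 2000 in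
theorem mem_ders : ∀ a : Fin 5, a ≠ 0 → ∀ b : Fin 5, b ≠ 1 ∧ b ≠ a →
    ∀ c : Fin 5, c ≠ 2 ∧ c ≠ a ∧ c ≠ b → ∀ d : Fin 5, d ≠ 3 ∧ d ≠ a ∧ d ≠ b ∧ d ≠ c →
    ∀ e : Fin 5, e ≠ 4 ∧ e ≠ a ∧ e ≠ b ∧ e ≠ c ∧ e ≠ d →
    [a.val, b.val, c.val, d.val, e.val] ∈ ders := by
  decide +kernel

def row (f : Fin 5 → Fin 5) : List ℕ :=
  [(f 0).val, (f 1).val, (f 2).val, (f 3).val, (f 4).val]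

theorem row_mem (f : Fin 5 → Fin 5) (hf : Function.Injective f) (h : ∀ j, f j ≠ j) :
    row f ∈ ders := by
  have H : ∀ i j : Fin 5, i ≠ j → f i ≠ f j := fun i j hij h => hij (hf h)
  exact mem_ders (f 0) (h 0) (f 1) ⟨h 1, H _ _ (by decide)⟩
    (f 2) ⟨h 2, H _ _ (by decide), H _ _ (by decide)⟩
    (f 3) ⟨h 3, H _ _ (by decide), H _ _ (by decide), H _ _ (by decide)⟩
    (f 4) ⟨h 4, H _ _ (by decide), H _ _ (by decide), H _ _ (by decide), H _ _ (by decide)⟩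

theorem nbeq_false {a b : Fin 5} (h : a ≠ b) : Nat.beq a.val b.val = false := by
  have : a.val ≠ b.val := fun h' => h (Fin.ext h')
  cases h2 : Nat.beq a.val b.val
  · rfl
  · exact absurd (Nat.eq_of_beq_eq_true h2) this

theorem compat_row {f g : Fin 5 → Fin 5} (h : ∀ j, f j ≠ g j) :
    compat (row f) (row g) = true := by
  simp only [row, compat, nbeq_false (h _)]
  rfl

theorem nbeq2_false {a b c d : Fin 5} (h : ¬ (a = c ∧ b = d)) :
    (Nat.beq a.val c.val && Nat.beq b.val d.val) = false := by
  by_cases h1 : a = c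
  · rw [nbeq_false (a := b) (fun h2 => h ⟨h1, h2⟩), Bool.and_false]
  · rw [nbeq_false h1, Bool.false_and]

theorem orth_row {f g f' g' : Fin 5 → Fin 5} (h : ∀ j j', ¬ (f' j' = f j ∧ g' j' = g j)) :
    orth (row f) (row g) (row f') (row g') = true := by
  simp only [row, orth, notIn, nbeq2_false (h _ _)]
  rfl

theorem pmul_row (f g : Fin 5 → Fin 5) : pmul (row f) (row g) = row (f ∘ g) := by
  have key : ∀ i : Fin 5, (row f).getD i.val 0 = (f i).val := by
    intro i
    fin_cases i <;> rfl
  simp only [pmul]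
  conv_lhs => rw [show row g = [(g 0).val, (g 1).val, (g 2).val, (g 3).val, (g 4).val] from rfl]
  simp only [List.map_cons, List.map_nil, key]
  rfl

theorem row_inj {f g : Fin 5 → Fin 5} (h : row f = row g) : f = g := by
  simp only [row, List.cons.injEq, Fin.val_inj, and_true] at h
  obtain ⟨h0, h1, h2, h3, h4⟩ := h
  funext i
  fin_cases i <;> assumption

theorem search_step {D : List (List ℕ)} {F : List (List ℕ × List ℕ) → Bool} {k n : ℕ}
    {rows : List (List ℕ × List ℕ)} (h : search D F (k + 1) n rows = true)
    {s t : List ℕ} (hs : s ∈ D) (ht : t ∈ D) (gs : guardS n s rows = true)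
    (gt : guardT s t rows = true) : search D F k (n + 1) ((s, t) :: rows) = true := by
  rw [search, List.all_eq_true] at h
  have h1 := h s hs
  rw [gs, Bool.not_true, Bool.false_or, List.all_eq_true] at h1
  have h2 := h1 t ht
  rwa [gt, Bool.not_true, Bool.false_or] at h2

theorem classify (L M : Fin 5 → Fin 5 → Fin 5)
    (L0 : ∀ j, L 0 j = j) (M0 : ∀ j, M 0 j = j) (Lc : ∀ i, L i 0 = i)
    (Linj : ∀ i, Function.Injective (L i)) (Minj : ∀ i, Function.Injective (M i))
    (Lne : ∀ i i' j, i ≠ i' → L i j ≠ L i' j) (Mne : ∀ i i' j, i ≠ i' → M i j ≠ M i' j)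
    (ort : ∀ i i' j j', L i j = L i' j' → M i j = M i' j' → i = i') :
    (∀ j, L 1 (L 1 (L 1 (L 1 (L 1 j)))) = j) ∧
    ((∀ j, M 1 j = L 1 (L 1 j)) ∨ (∀ j, M 1 j = L 1 (L 1 (L 1 j))) ∨
      (∀ j, M 1 j = L 1 (L 1 (L 1 (L 1 j))))) ∧
    ∃ i, i ≠ 0 ∧ (∀ j, L i j = L 1 (L 1 j)) ∧ (∀ j, M i j = M 1 (M 1 j)) := by
  have hs : ∀ i, i ≠ 0 → row (L i) ∈ ders := fun i hi =>
    row_mem _ (Linj i) (fun j => by have := Lne i 0 j hi; rwa [L0] at this)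
  have ht : ∀ i, i ≠ 0 → row (M i) ∈ ders := fun i hi =>
    row_mem _ (Minj i) (fun j => by have := Mne i 0 j hi; rwa [M0] at this)
  have hb : ∀ i, Nat.beq ((row (L i)).headD 0) i.val = true := by
    intro i
    simp [row, Lc]
  have hc : ∀ i i', i ≠ i' → compat (row (L i)) (row (L i')) = true := fun i i' h =>
    compat_row (fun j => Lne i i' j h)
  have hd : ∀ i i', i ≠ i' → compat (row (M i)) (row (M i')) = true := fun i i' h =>
    compat_row (fun j => Mne i i' j h)
  have he : ∀ i, i ≠ 0 → compat (row (L i)) (row (M i)) = true := fun i h =>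
    compat_row (fun j h' => h (ort i 0 j (L i j) (by rw [L0]) (by rw [M0, h'])))
  have ho : ∀ i i', i ≠ i' →
      orth (row (L i)) (row (M i)) (row (L i')) (row (M i')) = true := fun i i' h =>
    orth_row (fun j j' h' => h (ort i i' j j' h'.1.symm h'.2.symm))
  have S1 := search_step search_true (hs 1 (by decide)) (ht 1 (by decide))
    (by simp only [guardS, List.all_nil, Bool.and_true]; exact hb 1)
    (by simp only [guardT, List.all_nil, Bool.and_true]; exact he 1 (by decide))
  have S2 := search_step S1 (hs 2 (by decide)) (ht 2 (by decide))
    (by simp only [guardS, List.all_cons, List.all_nil, hc 2 1 (by decide), Bool.and_true]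
        exact hb 2)
    (by simp only [guardT, List.all_cons, List.all_nil, hd 2 1 (by decide),
          ho 2 1 (by decide), he 2 (by decide), Bool.and_true])
  have S3 := search_step S2 (hs 3 (by decide)) (ht 3 (by decide))
    (by simp only [guardS, List.all_cons, List.all_nil, hc 3 1 (by decide), hc 3 2 (by decide),
          Bool.and_true]
        exact hb 3)
    (by simp only [guardT, List.all_cons, List.all_nil, hd 3 1 (by decide), hd 3 2 (by decide),
          ho 3 1 (by decide), ho 3 2 (by decide), he 3 (by decide), Bool.and_true])
  have S4 := search_step S3 (hs 4 (by decide)) (ht 4 (by decide))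
    (by simp only [guardS, List.all_cons, List.all_nil, hc 4 1 (by decide), hc 4 2 (by decide),
          hc 4 3 (by decide), Bool.and_true]
        exact hb 4)
    (by simp only [guardT, List.all_cons, List.all_nil, hd 4 1 (by decide), hd 4 2 (by decide),
          hd 4 3 (by decide), ho 4 1 (by decide), ho 4 2 (by decide), ho 4 3 (by decide),
          he 4 (by decide), Bool.and_true])
  have hid : ([0, 1, 2, 3, 4] : List ℕ) = row id := rfl
  simp only [search, finish, leaf, pmul_row, hid, List.any_cons, List.any_nil, Bool.and_eq_true,
    Bool.or_eq_true, beq_iff_eq, Bool.or_false] at S4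
  obtain ⟨⟨h1, h2⟩, h3⟩ := S4
  refine ⟨fun j => congrFun (row_inj h1) j, ?_, ?_⟩
  · rcases h2 with (h2 | h2) | h2
    · exact Or.inl fun j => congrFun (row_inj h2) j
    · exact Or.inr (Or.inl fun j => congrFun (row_inj h2) j)
    · exact Or.inr (Or.inr fun j => congrFun (row_inj h2) j)
  · rcases h3 with h3 | h3 | h3
    · exact ⟨2, by decide, fun j => congrFun (row_inj h3.1) j, fun j => congrFun (row_inj h3.2) j⟩
    · exact ⟨3, by decide, fun j => congrFun (row_inj h3.1) j, fun j => congrFun (row_inj h3.2) j⟩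
    · exact ⟨4, by decide, fun j => congrFun (row_inj h3.1) j, fun j => congrFun (row_inj h3.2) j⟩
theorem geo (f : Fin 5 → ℂ) (z : ℂ) (h : ∀ k, f (k + 1 + 1) - f (k + 1) = z * (f (k + 1) - f k))
    (h01 : f 1 ≠ f 0) : 1 + z + z ^ 2 + z ^ 3 + z ^ 4 = 0 ∧
      ∃ A B, B ≠ 0 ∧ ∀ k : Fin 5, f k = A + B * z ^ k.val := by
  have e0 : f 2 - f 1 = z * (f 1 - f 0) := h 0
  have e1 : f 3 - f 2 = z * (f 2 - f 1) := h 1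
  have e2 : f 4 - f 3 = z * (f 3 - f 2) := h 2
  have e3 : f 0 - f 4 = z * (f 4 - f 3) := h 3
  have hD : f 1 - f 0 ≠ 0 := sub_ne_zero.2 h01
  have f2 : f 2 = f 1 + z * (f 1 - f 0) := by linear_combination e0
  have f3 : f 3 = f 2 + z ^ 2 * (f 1 - f 0) := by linear_combination e1 + z * e0
  have f4 : f 4 = f 3 + z ^ 3 * (f 1 - f 0) := by linear_combination e2 + z * e1 + z ^ 2 * e0
  have f5 : f 0 = f 4 + z ^ 4 * (f 1 - f 0) := by
    linear_combination e3 + z * e2 + z ^ 2 * e1 + z ^ 3 * e0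
  have hS : 1 + z + z ^ 2 + z ^ 3 + z ^ 4 = 0 := by
    have : (f 1 - f 0) * (1 + z + z ^ 2 + z ^ 3 + z ^ 4) = 0 := by
      linear_combination -f2 - f3 - f4 - f5
    exact (mul_eq_zero.1 this).resolve_left hD
  refine ⟨hS, ?_⟩
  have hz : z - 1 ≠ 0 := by
    intro hz
    have : z = 1 := by linear_combination hz
    subst this
    norm_num at hS
  refine ⟨f 0 - (f 1 - f 0) / (z - 1), (f 1 - f 0) / (z - 1), div_ne_zero hD hz, ?_⟩
  have hB : (f 1 - f 0) / (z - 1) * (z - 1) = f 1 - f 0 := div_mul_cancel₀ _ hz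
  generalize (f 1 - f 0) / (z - 1) = B at hB ⊢
  intro k
  fin_cases k
  · simp
  · simp; linear_combination -hB
  · simp; linear_combination f2 - (1 + z) * hB
  · simp; linear_combination f3 + f2 - (1 + z + z ^ 2) * hB
  · simp; linear_combination f4 + f3 + f2 - (1 + z + z ^ 2 + z ^ 3) * hB

theorem fin_contra (x y : Fin 5 → ℂ) (z A B C D p q : ℂ)
    (hS : 1 + z + z ^ 2 + z ^ 3 + z ^ 4 = 0) (hB : B ≠ 0) (hD : D ≠ 0)
    (hx : ∀ k : Fin 5, x k = A + B * z ^ k.val) (hy : ∀ k : Fin 5, y (2 * k) = C + D * z ^ k.val)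
    (hxy : ∀ k, y k * (p + q * x k) = x k) : False := by
  have y0 : y 0 = C + D := by simpa using hy 0
  have y2 : y 2 = C + D * z := by simpa using hy 1
  have y4 : y 4 = C + D * z ^ 2 := by simpa using hy 2
  have y1 : y 1 = C + D * z ^ 3 := by simpa using hy 3
  have y3 : y 3 = C + D * z ^ 4 := by simpa using hy 4
  have x0 : x 0 = A + B := by simpa using hx 0
  have x1 : x 1 = A + B * z := by simpa using hx 1
  have x2 : x 2 = A + B * z ^ 2 := by simpa using hx 2
  have x3 : x 3 = A + B * z ^ 3 := by simpa using hx 3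
  have x4 : x 4 = A + B * z ^ 4 := by simpa using hx 4
  have E0 := hxy 0
  have E1 := hxy 2
  have E2 := hxy 4
  have E3 := hxy 1
  have E4 := hxy 3
  rw [y0, x0] at E0
  rw [y2, x2] at E1
  rw [y4, x4] at E2
  rw [y1, x1] at E3
  rw [y3, x3] at E4
  have h5 : z ^ 5 = 1 := by linear_combination (z - 1) * hS
  have hq : 5 * (D * q * B) = 0 := by
    linear_combination E0 + z ^ 2 * E1 + z ^ 4 * (E2 - D * q * B * z * h5) + z * E3
      + z ^ 3 * (E4 - D * q * B * z ^ 2 * h5)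
      - 4 * (D * q * B) * h5 - (C * q * B - B) * (hS + (z ^ 3 + z) * h5)
      - D * (p + q * A) * (hS + (z + z ^ 2) * h5) - (C * (p + q * A) - A) * hS
  have hq0 : q = 0 := by
    simpa [hB, hD] using hq
  have hc : 5 * (C * q * B - B) = 0 := by
    linear_combination E0 + z ^ 3 * E1 + z * (E2 - D * q * B * z * h5) + z ^ 4 * E3
      + z ^ 2 * (E4 - D * q * B * z ^ 2 * h5)
      - 4 * (C * q * B - B) * h5 - D * q * B * (hS + (z ^ 3 + z) * h5)
      - D * (p + q * A) * (hS + (z + z ^ 2) * h5) - (C * (p + q * A) - A) * hS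
  rw [hq0] at hc
  apply hB
  linear_combination (-1 / 5) * hc

theorem core (x y : Fin 5 → ℂ) (t p q : ℂ) (u : Fin 5) (hu : u = 2 ∨ u = 3 ∨ u = 4)
    (hx : ∀ k, x (k + 1) - x k = t * (x (k + u) - x k))
    (hy : ∀ k, y (k + 2) - y k = t * (y (k + 2 * u) - y k))
    (nx : ∀ k, x (k + 1) ≠ x k) (ny : ∀ k, y (k + 2) ≠ y k)
    (hxy : ∀ k, y k * (p + q * x k) = x k) : False := by
  have ht : t ≠ 0 := by
    rintro rfl
    apply nx 0
    linear_combination hx 0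
  rcases hu with rfl | rfl | rfl
  · obtain ⟨hS, A, B, hB, hxk⟩ := geo x ((1 - t) / t) (by
      intro k
      have h := hx k
      rw [show k + 2 = k + 1 + 1 by grind] at h
      field_simp
      linear_combination -h) (nx 0)
    obtain ⟨-, C, D, hD, hyk⟩ := geo (fun k => y (2 * k)) ((1 - t) / t) (by
      intro k
      have h := hy (2 * k)
      rw [show 2 * k + 2 * 2 = 2 * (k + 1 + 1) by grind,
        show 2 * k + 2 = 2 * (k + 1) by grind] at h
      field_simp
      linear_combination -h) (ny 0)
    exact fin_contra x y _ A B C D p q hS hB hD hxk hyk hxy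
  · obtain ⟨hS, A, B, hB, hxk⟩ := geo (fun k => x (3 * k)) (t - 1) (by
      intro k
      have h := hx (3 * k)
      rw [show 3 * k + 3 = 3 * (k + 1) by grind,
        show 3 * k + 1 = 3 * (k + 1 + 1) by clear h; revert k; decide] at h
      linear_combination h) (by
        intro h
        apply nx 0
        have h' := hx 0
        have h2 : x (0 + 3) = x 0 := h
        rw [h2] at h'
        linear_combination h')
    obtain ⟨-, C, D, hD, hyk⟩ := geo y (t - 1) (by
      intro k
      have h := hy k
      rw [show k + 2 * 3 = k + 1 by clear h; revert k; decide,
        show k + 2 = k + 1 + 1 by grind] at h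
      linear_combination h) (by
        intro h
        apply ny 0
        have h' := hy 0
        have h2 : y (0 + 2 * 3) = y 0 := h
        rw [h2] at h'
        linear_combination h')
    exact fin_contra (fun k => x (3 * k)) (fun k => y (3 * k)) _ A B C D p q hS hB hD hxk
      (fun k => by
        have h2 : 3 * (2 * k) = k := by revert k; decide
        simp only [h2]
        exact hyk k) (fun k => hxy (3 * k))
  · obtain ⟨hS, A, B, hB, hxk⟩ := geo x (-t) (by
      intro k
      have h := hx (k + 1)
      rw [show k + 1 + 4 = k by clear h; revert k; decide] at h
      linear_combination h) (nx 0)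
    obtain ⟨-, C, D, hD, hyk⟩ := geo (fun k => y (2 * k)) (-t) (by
      intro k
      have h := hy (2 * (k + 1))
      rw [show 2 * (k + 1) + 2 * 4 = 2 * k by clear h; revert k; decide,
        show 2 * (k + 1) + 2 = 2 * (k + 1 + 1) by grind] at h
      linear_combination h) (ny 0)
    exact fin_contra x y _ A B C D p q hS hB hD hxk hyk hxy

/-- Dual space of `ℂ³`. -/
abbrev Dl := (Fin 3 → ℂ) →ₗ[ℂ] ℂ

theorem prod_erase {g : Fin 5 → ℂ} {i : Fin 5}
    (σ : Fin 5 → Fin 5) (hσ : Function.Injective σ) (C A : Fin 5 → ℂ)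
    (h : ∀ j, j ≠ i → C (σ j) = g j * A j) :
    g i * ∏ k ∈ Finset.univ.erase (σ i), C k =
      (∏ j, g j) * ∏ j ∈ Finset.univ.erase i, A j := by
  have e : Finset.univ.erase (σ i) = (Finset.univ.erase i).image σ := by
    rw [Finset.image_erase hσ, Finset.image_univ_of_surjective
      (Finite.injective_iff_surjective.1 hσ)]
  rw [e, Finset.prod_image (fun x _ y _ hxy => hσ hxy),
    Finset.prod_congr rfl (fun j hj => h j (Finset.ne_of_mem_erase hj)),
    Finset.prod_mul_distrib, ← Finset.mul_prod_erase Finset.univ g (Finset.mem_univ i)]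
  ring

theorem lam_const (a b c : Fin 5 → Dl) (L : Fin 5 → Fin 5 → Fin 5)
    (Linj : ∀ i, Function.Injective (L i)) (α β : Fin 5 → Fin 5 → ℂ)
    (hc : ∀ i j, c (L i j) = α i j • a i + β i j • b j)
    (hQ : ∀ i i', i ≠ i' → ∃ Q, a i Q = 0 ∧ a i' Q = 0 ∧ ∀ j, b j Q ≠ 0) (i i' : Fin 5) :
    ∏ j, β i j = ∏ j, β i' j := by
  by_cases h : i = i'
  · rw [h]
  obtain ⟨Q, h1, h2, h3⟩ := hQ i i' h
  have key : ∀ i, a i Q = 0 → ∏ k, c k Q = (∏ j, β i j) * ∏ j, b j Q := by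
    intro i hi
    rw [← Finset.prod_mul_distrib,
      ← Function.Bijective.prod_comp (Finite.injective_iff_bijective.1 (Linj i)) (fun k => c k Q)]
    refine Finset.prod_congr rfl fun j _ => ?_
    rw [hc]
    simp [hi]
  have hb : ∏ j, b j Q ≠ 0 := Finset.prod_ne_zero_iff.2 fun j _ => h3 j
  exact mul_right_cancel₀ hb ((key i h1).symm.trans (key i' h2))

theorem three_net (a b c : Fin 5 → Dl) (L : Fin 5 → Fin 5 → Fin 5)
    (Linj : ∀ i, Function.Injective (L i)) (Linj' : ∀ j, Function.Injective (fun i => L i j))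
    (α β : Fin 5 → Fin 5 → ℂ) (hα : ∀ i j, α i j ≠ 0) (hβ : ∀ i j, β i j ≠ 0)
    (hc : ∀ i j, c (L i j) = α i j • a i + β i j • b j)
    (P : Fin 5 → Fin 5 → (Fin 3 → ℂ)) (hPa : ∀ i j, a i (P i j) = 0)
    (hPb : ∀ i j, b j (P i j) = 0)
    (hQa : ∀ i i', i ≠ i' → ∃ Q, a i Q = 0 ∧ a i' Q = 0 ∧ ∀ j, b j Q ≠ 0)
    (hQb : ∀ j j', j ≠ j' → ∃ Q, b j Q = 0 ∧ b j' Q = 0 ∧ ∀ i, a i Q ≠ 0) :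
    ∃ l m : ℂ, l ≠ 0 ∧ m ≠ 0 ∧ ∀ i j,
      m * (∏ i' ∈ Finset.univ.erase i, a i' (P i j)) * β i j =
      l * (∏ j' ∈ Finset.univ.erase j, b j' (P i j)) * α i j := by
  refine ⟨∏ j, β 0 j, ∏ i, α i 0, Finset.prod_ne_zero_iff.2 fun j _ => hβ _ _,
    Finset.prod_ne_zero_iff.2 fun j _ => hα _ _, fun i j => ?_⟩
  have hl := lam_const a b c L Linj α β hc hQa 0 i
  have hm := lam_const b a c (fun j i => L i j) Linj' (fun j i => β i j) (fun j i => α i j)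
    (fun j i => by rw [hc, add_comm]) hQb 0 j
  have e1 := prod_erase (g := fun j => β i j) (i := j) (L i) (Linj i)
    (fun k => c k (P i j)) (fun j' => b j' (P i j)) (fun j' _ => by
      simp [hc, hPa])
  have e2 := prod_erase (g := fun i => α i j) (i := i)
    (fun i => L i j) (Linj' j)
    (fun k => c k (P i j)) (fun i' => a i' (P i j)) (fun i' _ => by
      simp [hc, hPb])
  rw [hl, hm]
  linear_combination (α i j) * e1 - (β i j) * e2

theorem row_rel (a b c : Fin 5 → Dl) (L : Fin 5 → Fin 5 → Fin 5)
    (L0 : ∀ j, L 0 j = j)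
    (α β : Fin 5 → Fin 5 → ℂ) (hβ : ∀ i j, β i j ≠ 0)
    (hc : ∀ i j, c (L i j) = α i j • a i + β i j • b j)
    (i : Fin 5) (U w : Fin 3 → ℂ) (hU0 : a 0 U = 0) (hUi : a i U = 0) (hUb : ∀ j, b j U ≠ 0)
    (hw : a 0 w = 0) (j : Fin 5) :
    b (L i j) w / b (L i j) U - b j w / b j U = α i j / β i j * (a i w / b j U) := by
  have h0 : c (L i j) = α 0 (L i j) • a 0 + β 0 (L i j) • b (L i j) := by
    rw [← hc, L0]
  have h1 : β 0 (L i j) * b (L i j) U = β i j * b j U := by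
    have h : c (L i j) U = c (L i j) U := rfl
    conv_lhs at h => rw [h0]
    rw [hc] at h
    simpa [hU0, hUi] using h
  have h2 : β 0 (L i j) * b (L i j) w = α i j * a i w + β i j * b j w := by
    have h : c (L i j) w = c (L i j) w := rfl
    conv_lhs at h => rw [h0]
    rw [hc] at h
    simpa [hw] using h
  have n1 := hβ i j
  have n2 := hβ 0 (L i j)
  have n3 := hUb j
  have n4 := hUb (L i j)
  generalize b (L i j) U = B1 at *
  generalize b (L i j) w = B2 at *
  generalize β 0 (L i j) = b0 at *
  have h3 : B2 / B1 = (b0 * B2) / (b0 * B1) := by field_simp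
  rw [h3, h1, h2]
  field_simp
  ring

theorem config_normal (a b c d : Fin 5 → Dl) (L M : Fin 5 → Fin 5 → Fin 5)
    (L0 : ∀ j, L 0 j = j) (M0 : ∀ j, M 0 j = j) (Lc : ∀ i, L i 0 = i)
    (Linj : ∀ i, Function.Injective (L i)) (Minj : ∀ i, Function.Injective (M i))
    (Linj' : ∀ j, Function.Injective (fun i => L i j))
    (Minj' : ∀ j, Function.Injective (fun i => M i j))
    (ort : ∀ i i' j j', L i j = L i' j' → M i j = M i' j' → i = i')
    (hc : ∀ i j, ∃ α β : ℂ, α ≠ 0 ∧ β ≠ 0 ∧ c (L i j) = α • a i + β • b j)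
    (hd : ∀ i j, ∃ α β : ℂ, α ≠ 0 ∧ β ≠ 0 ∧ d (M i j) = α • a i + β • b j)
    (hP : ∀ i j, ∃ P, a i P = 0 ∧ b j P = 0 ∧ (∀ i', i' ≠ i → a i' P ≠ 0) ∧
      (∀ j', j' ≠ j → b j' P ≠ 0))
    (hQa : ∀ i i', i ≠ i' → ∃ Q, a i Q = 0 ∧ a i' Q = 0 ∧ (∀ j, b j Q ≠ 0) ∧
      ∀ v, a i v = 0 → a i' v = 0 → ∃ r : ℂ, v = r • Q)
    (hQb : ∀ j j', j ≠ j' → ∃ Q, b j Q = 0 ∧ b j' Q = 0 ∧ (∀ i, a i Q ≠ 0)) : False := by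
  obtain ⟨h5, hu, i, hi0, hLi, hMi⟩ := classify L M L0 M0 Lc Linj Minj
    (fun i i' j h h' => h (Linj' j h')) (fun i i' j h h' => h (Minj' j h')) ort
  choose α β hα hβ hc using hc
  choose γ δ hγ hδ hd using hd
  choose P hPa hPb hPa' hPb' using hP
  have hQa' : ∀ i i', i ≠ i' → ∃ Q, a i Q = 0 ∧ a i' Q = 0 ∧ ∀ j, b j Q ≠ 0 := fun i i' h => by
    obtain ⟨Q, h1, h2, h3, -⟩ := hQa i i' h
    exact ⟨Q, h1, h2, h3⟩
  obtain ⟨l, m, hl, hm, hlm⟩ := three_net a b c L Linj Linj' α β hα hβ hc P hPa hPb hQa' hQb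
  obtain ⟨l', m', hl', hm', hlm'⟩ := three_net a b d M Minj Minj' γ δ hγ hδ hd P hPa hPb hQa' hQb
  -- the constant cross ratio
  have cross : ∀ i j, α i j / β i j = (m * l') / (l * m') * (γ i j / δ i j) := by
    intro i j
    have e1 := hlm i j
    have e2 := hlm' i j
    have nA : ∏ i' ∈ Finset.univ.erase i, a i' (P i j) ≠ 0 :=
      Finset.prod_ne_zero_iff.2 fun i' h => hPa' i j i' (Finset.ne_of_mem_erase h)
    have nB : ∏ j' ∈ Finset.univ.erase j, b j' (P i j) ≠ 0 :=
      Finset.prod_ne_zero_iff.2 fun i' h => hPb' i j i' (Finset.ne_of_mem_erase h)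
    generalize ∏ i' ∈ Finset.univ.erase i, a i' (P i j) = A' at *
    generalize ∏ j' ∈ Finset.univ.erase j, b j' (P i j) = B' at *
    have n1 := hβ i j
    have n2 := hδ i j
    have key : A' * B' * (α i j * (l * m') * δ i j - β i j * (m * l' * γ i j)) = 0 := by
      linear_combination (-m' * A' * δ i j) * e1 + (m * A' * β i j) * e2
    have key2 := (mul_eq_zero.1 key).resolve_left (mul_ne_zero nA nB)
    rw [div_mul_div_comm, div_eq_div_iff n1 (by positivity)]
    linear_combination key2
  set t := (m * l') / (l * m') with ht
  obtain ⟨U, hU0, hU1, hUb, hUs⟩ := hQa 0 1 (by decide)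
  obtain ⟨V, hV0, hVi, hVb, -⟩ := hQa 0 i hi0.symm
  have hw0 := hPa 0 0
  have hw' := hPa' 0 0
  generalize P 0 0 = w at hw0 hw'
  have hw1 : a 1 w ≠ 0 := hw' 1 (by decide)
  have hwi : a i w ≠ 0 := hw' i hi0
  obtain ⟨p, hp⟩ := hUs (V - (a 1 V / a 1 w) • w) (by simp [hV0, hw0]) (by
    simp [div_mul_cancel₀ _ hw1])
  have hV : V = p • U + (a 1 V / a 1 w) • w := by rw [← hp]; abel
  have rL1 := row_rel a b c L L0 α β hβ hc 1 U w hU0 hU1 hUb hw0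
  have rM1 := row_rel a b d M M0 γ δ hδ hd 1 U w hU0 hU1 hUb hw0
  have rLi := row_rel a b c L L0 α β hβ hc i V w hV0 hVi hVb hw0
  have rMi := row_rel a b d M M0 γ δ hδ hd i V w hV0 hVi hVb hw0
  obtain ⟨e, he⟩ : ∃ e : Fin 5 → Fin 5, ∀ k, L 1 (e k) = e (k + 1) := by
    refine ⟨fun k => (L 1)^[k.val] 0, fun k => ?_⟩
    fin_cases k
    · rfl
    · rfl
    · rfl
    · rfl
    · exact h5 0
  obtain ⟨u, hu2, hMu⟩ : ∃ u : Fin 5, (u = 2 ∨ u = 3 ∨ u = 4) ∧ ∀ k, M 1 (e k) = e (k + u) := by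
    rcases hu with hu | hu | hu
    · refine ⟨2, by decide, fun k => ?_⟩
      rw [hu, he, he]
      congr 1
      grind
    · refine ⟨3, by decide, fun k => ?_⟩
      rw [hu, he, he, he]
      congr 1
      grind
    · refine ⟨4, by decide, fun k => ?_⟩
      rw [hu, he, he, he, he]
      congr 1
      grind
  have hLi' : ∀ k, L i (e k) = e (k + 2) := fun k => by
    rw [hLi, he, he]
    congr 1
    grind
  have hMi' : ∀ k, M i (e k) = e (k + 2 * u) := fun k => by
    rw [hMi, hMu, hMu]
    congr 1
    grind
  refine core (fun k => b (e k) w / b (e k) U) (fun k => b (e k) w / b (e k) V) t p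
    (a 1 V / a 1 w) u hu2 ?_ ?_ ?_ ?_ ?_
  · intro k
    have h1 := rL1 (e k)
    have h2 := rM1 (e k)
    rw [he] at h1
    rw [hMu] at h2
    rw [h1, h2, cross]
    ring
  · intro k
    have h1 := rLi (e k)
    have h2 := rMi (e k)
    rw [hLi'] at h1
    rw [hMi'] at h2
    rw [h1, h2, cross]
    ring
  · intro k h
    have h1 := rL1 (e k)
    rw [he] at h1
    rw [h, sub_self] at h1
    exact mul_ne_zero (div_ne_zero (hα _ _) (hβ _ _)) (div_ne_zero hw1 (hUb _)) h1.symm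
  · intro k h
    have h1 := rLi (e k)
    rw [hLi'] at h1
    rw [h, sub_self] at h1
    exact mul_ne_zero (div_ne_zero (hα _ _) (hβ _ _)) (div_ne_zero hwi (hVb _)) h1.symm
  · intro k
    have h1 : b (e k) V = p * b (e k) U + (a 1 V / a 1 w) * b (e k) w := by
      conv_lhs => rw [hV]
      simp
    have n1 := hUb (e k)
    have n2 := hVb (e k)
    generalize a 1 V / a 1 w = q at *
    have h3 : p + q * (b (e k) w / b (e k) U) = b (e k) V / b (e k) U := by
      rw [h1]
      field_simp
    rw [h3]
    field_simp

theorem config (a b c d : Fin 5 → Dl) (L M : Fin 5 → Fin 5 → Fin 5)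
    (Linj : ∀ i, Function.Injective (L i)) (Minj : ∀ i, Function.Injective (M i))
    (Linj' : ∀ j, Function.Injective (fun i => L i j))
    (Minj' : ∀ j, Function.Injective (fun i => M i j))
    (ort : ∀ i i' j j', L i j = L i' j' → M i j = M i' j' → i = i')
    (hc : ∀ i j, ∃ α β : ℂ, α ≠ 0 ∧ β ≠ 0 ∧ c (L i j) = α • a i + β • b j)
    (hd : ∀ i j, ∃ α β : ℂ, α ≠ 0 ∧ β ≠ 0 ∧ d (M i j) = α • a i + β • b j)
    (hP : ∀ i j, ∃ P, a i P = 0 ∧ b j P = 0 ∧ (∀ i', i' ≠ i → a i' P ≠ 0) ∧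
      (∀ j', j' ≠ j → b j' P ≠ 0))
    (hQa : ∀ i i', i ≠ i' → ∃ Q, a i Q = 0 ∧ a i' Q = 0 ∧ (∀ j, b j Q ≠ 0) ∧
      ∀ v, a i v = 0 → a i' v = 0 → ∃ r : ℂ, v = r • Q)
    (hQb : ∀ j j', j ≠ j' → ∃ Q, b j Q = 0 ∧ b j' Q = 0 ∧ (∀ i, a i Q ≠ 0)) : False := by
  let π : Fin 5 ≃ Fin 5 := Equiv.ofBijective (L 0) (Finite.injective_iff_bijective.1 (Linj 0))
  let κ : Fin 5 ≃ Fin 5 := Equiv.ofBijective (M 0) (Finite.injective_iff_bijective.1 (Minj 0))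
  let ρ : Fin 5 ≃ Fin 5 := (Equiv.ofBijective (fun i => L i 0)
    (Finite.injective_iff_bijective.1 (Linj' 0))).trans π.symm
  have hρ0 : ρ.symm 0 = 0 := by
    rw [Equiv.symm_apply_eq]
    change 0 = π.symm (π 0)
    simp
  have hρ : ∀ i, L i 0 = π (ρ i) := fun i => by
    change L i 0 = π (π.symm (L i 0))
    simp
  refine config_normal (fun i => a (ρ.symm i)) b (fun k => c (π k)) (fun k => d (κ k))
    (fun i j => π.symm (L (ρ.symm i) j)) (fun i j => κ.symm (M (ρ.symm i) j))
    ?_ ?_ ?_ ?_ ?_ ?_ ?_ ?_ ?_ ?_ ?_ ?_ ?_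
  · intro j
    simp only [hρ0]
    exact π.symm_apply_apply j
  · intro j
    simp only [hρ0]
    exact κ.symm_apply_apply j
  · intro i
    simp [hρ]
  · intro i
    exact π.symm.injective.comp (Linj _)
  · intro i
    exact κ.symm.injective.comp (Minj _)
  · intro j
    exact π.symm.injective.comp ((Linj' j).comp ρ.symm.injective)
  · intro j
    exact κ.symm.injective.comp ((Minj' j).comp ρ.symm.injective)
  · intro i i' j j' h h'
    exact ρ.symm.injective (ort _ _ j j' (π.symm.injective h) (κ.symm.injective h'))
  · intro i j
    simpa using hc (ρ.symm i) j
  · intro i j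
    simpa using hd (ρ.symm i) j
  · intro i j
    obtain ⟨P, h1, h2, h3, h4⟩ := hP (ρ.symm i) j
    exact ⟨P, h1, h2, fun i' hi => h3 _ (fun h => hi (ρ.symm.injective h)), h4⟩
  · intro i i' h
    exact hQa _ _ (fun h' => h (ρ.symm.injective h'))
  · intro j j' h
    obtain ⟨Q, h1, h2, h3⟩ := hQb j j' h
    exact ⟨Q, h1, h2, fun i => h3 _⟩

theorem exists_dual (l : Submodule ℂ (Fin 3 → ℂ)) (h : Module.finrank ℂ l = 2) :
    ∃ f : Dl, LinearMap.ker f = l := by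
  have hlt : l < ⊤ := by
    refine lt_top_iff_ne_top.2 fun h' => ?_
    rw [h', finrank_top] at h
    simp at h
  obtain ⟨f, hf, hle⟩ := Submodule.exists_le_ker_of_lt_top l hlt
  refine ⟨f, (Submodule.eq_of_le_of_finrank_eq hle ?_).symm⟩
  have h1 := LinearMap.finrank_range_add_finrank_ker f
  have h2 : LinearMap.range f = ⊤ := LinearMap.range_eq_top.2 (LinearMap.surjective hf)
  rw [h2, finrank_top] at h1
  simp at h1
  omega

theorem inf_dim (l l' : Submodule ℂ (Fin 3 → ℂ)) (h : Module.finrank ℂ l = 2)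
    (h' : Module.finrank ℂ l' = 2) (hne : l ≠ l') :
    Module.finrank ℂ (l ⊓ l' : Submodule ℂ (Fin 3 → ℂ)) = 1 := by
  have h1 := Submodule.finrank_sup_add_finrank_inf_eq l l'
  have h2 : Module.finrank ℂ (l ⊔ l' : Submodule ℂ (Fin 3 → ℂ)) ≤ 3 := by
    simpa using Submodule.finrank_le (l ⊔ l')
  have h3 : Module.finrank ℂ (l ⊓ l' : Submodule ℂ (Fin 3 → ℂ)) ≠ 2 := by
    intro h3
    have e1 := Submodule.eq_of_le_of_finrank_eq (inf_le_left : l ⊓ l' ≤ l) (by omega)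
    have e2 := Submodule.eq_of_le_of_finrank_eq (inf_le_right : l ⊓ l' ≤ l') (by omega)
    exact hne (e1.symm.trans e2)
  have h4 := Submodule.finrank_mono (inf_le_left : l ⊓ l' ≤ l)
  omega

theorem exists_gen (X : Submodule ℂ (Fin 3 → ℂ)) (h : Module.finrank ℂ X = 1) :
    ∃ P ∈ X, ∀ v ∈ X, ∃ r : ℂ, v = r • P := by
  obtain ⟨⟨P, hP⟩, -, h2⟩ := finrank_eq_one_iff'.1 h
  refine ⟨P, hP, fun v hv => ?_⟩
  obtain ⟨r, hr⟩ := h2 ⟨v, hv⟩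
  exact ⟨r, (congrArg Subtype.val hr).symm⟩

theorem exists_comb (a b c : Dl) (ha : Module.finrank ℂ (LinearMap.ker a) = 2)
    (hb : Module.finrank ℂ (LinearMap.ker b) = 2) (hc : Module.finrank ℂ (LinearMap.ker c) = 2)
    (hac : LinearMap.ker a ≠ LinearMap.ker c) (hbc : LinearMap.ker b ≠ LinearMap.ker c)
    (h : LinearMap.ker a ⊓ LinearMap.ker b ≤ LinearMap.ker c) :
    ∃ α β : ℂ, α ≠ 0 ∧ β ≠ 0 ∧ c = α • a + β • b := by
  have h1 : c ∈ Submodule.span ℂ (Set.range ![a, b]) := by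
    apply mem_span_of_iInf_ker_le_ker
    refine le_trans ?_ h
    intro v hv
    rw [Submodule.mem_iInf] at hv
    exact ⟨hv 0, hv 1⟩
  rw [Matrix.range_cons, Matrix.range_cons, Matrix.range_empty, Set.union_empty,
    Set.singleton_union, Submodule.mem_span_pair] at h1
  obtain ⟨α, β, rfl⟩ := h1
  refine ⟨α, β, ?_, ?_, rfl⟩
  · rintro rfl
    apply hbc
    refine Submodule.eq_of_le_of_finrank_eq (fun v hv => ?_) (hb.trans hc.symm)
    rw [LinearMap.mem_ker] at hv ⊢
    simp [hv]
  · rintro rfl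
    apply hac
    refine Submodule.eq_of_le_of_finrank_eq (fun v hv => ?_) (ha.trans hc.symm)
    rw [LinearMap.mem_ker] at hv ⊢
    simp [hv]

theorem main (A : Fin 4 → Finset (Submodule ℂ (Fin 3 → ℂ)))
    (χ : Finset (Submodule ℂ (Fin 3 → ℂ))) (N : IsNet 4 5 A χ) : False := by
  obtain ⟨ln, hmem, hinj, hsurj⟩ : ∃ ln : Fin 4 → Fin 5 → Submodule ℂ (Fin 3 → ℂ),
      (∀ r k, ln r k ∈ A r) ∧ (∀ r, Function.Injective (ln r)) ∧
      (∀ r, ∀ l ∈ A r, ∃ k, ln r k = l) := by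
    let E : ∀ r, Fin 5 ≃ A r := fun r => (Finset.equivFinOfCardEq (N.card_eq r)).symm
    refine ⟨fun r k => (E r k).1, fun r k => (E r k).2,
      fun r k k' h => (E r).injective (Subtype.ext h), fun r l hl => ⟨(E r).symm ⟨l, hl⟩, ?_⟩⟩
    simp
  have dim2 : ∀ r k, Module.finrank ℂ (ln r k) = 2 := fun r k => N.line_dim r _ (hmem r k)
  choose φ hφ using fun r k => exists_dual (ln r k) (dim2 r k)
  have φ0 : ∀ r k v, φ r k v = 0 ↔ v ∈ ln r k := fun r k v => by
    rw [← hφ, LinearMap.mem_ker]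
  have pt : ∀ p q i j, p ≠ q → ln p i ⊓ ln q j ∈ χ := fun p q i j h =>
    (N.inter_mem p q h _ (hmem p i) _ (hmem q j)).2
  have lne : ∀ p q i j, p ≠ q → ln p i ≠ ln q j := fun p q i j h =>
    (N.inter_mem p q h _ (hmem p i) _ (hmem q j)).1
  have uniq : ∀ X ∈ χ, ∀ r k k', X ≤ ln r k → X ≤ ln r k' → k = k' := fun X hX r k k' h h' =>
    hinj r ((N.unique_line X hX r).unique ⟨hmem r k, h⟩ ⟨hmem r k', h'⟩)
  have eqinf : ∀ X ∈ χ, ∀ p q i j, p ≠ q → X ≤ ln p i → X ≤ ln q j → X = ln p i ⊓ ln q j :=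
    fun X hX p q i j h h1 h2 => Submodule.eq_of_le_of_finrank_eq (le_inf h1 h2)
      ((N.point_dim X hX).trans (N.point_dim _ (pt p q i j h)).symm)
  have ex : ∀ r i j, ∃ k, ln 0 i ⊓ ln 1 j ≤ ln r k := fun r i j => by
    obtain ⟨l, ⟨hl, hl'⟩, -⟩ := N.unique_line _ (pt 0 1 i j (by decide)) r
    obtain ⟨k, rfl⟩ := hsurj r l hl
    exact ⟨k, hl'⟩
  choose T hT using ex
  have hX : ∀ i j, ln 0 i ⊓ ln 1 j ∈ χ := fun i j => pt 0 1 i j (by decide)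
  have Tinj : ∀ r, r ≠ 0 → ∀ i, Function.Injective (T r i) := by
    intro r hr i j j' h
    have h1 := eqinf _ (hX i j) 0 r i (T r i j) hr.symm inf_le_left (hT r i j)
    have h2 := eqinf _ (hX i j') 0 r i (T r i j') hr.symm inf_le_left (hT r i j')
    rw [h, ← h2] at h1
    exact uniq _ (hX i j) 1 j j' inf_le_right (h1 ▸ inf_le_right)
  have Tinj' : ∀ r, r ≠ 1 → ∀ j, Function.Injective (fun i => T r i j) := by
    intro r hr j i i' h
    have h1 := eqinf _ (hX i j) 1 r j (T r i j) hr.symm inf_le_right (hT r i j)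
    have h2 := eqinf _ (hX i' j) 1 r j (T r i' j) hr.symm inf_le_right (hT r i' j)
    have h : T r i j = T r i' j := h
    rw [h, ← h2] at h1
    exact uniq _ (hX i j) 0 i i' inf_le_left (h1 ▸ inf_le_left)
  have comb : ∀ r, r ≠ 0 → r ≠ 1 → ∀ i j, ∃ α β : ℂ, α ≠ 0 ∧ β ≠ 0 ∧
      φ r (T r i j) = α • φ 0 i + β • φ 1 j := by
    intro r h0 h1 i j
    apply exists_comb
    · rw [hφ, dim2]
    · rw [hφ, dim2]
    · rw [hφ, dim2]
    · rw [hφ, hφ]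
      exact lne _ _ _ _ h0.symm
    · rw [hφ, hφ]
      exact lne _ _ _ _ h1.symm
    · rw [hφ, hφ, hφ]
      exact hT r i j
  have hQ : ∀ p q, p ≠ q → ∀ i i', i ≠ i' → ∃ Q, φ p i Q = 0 ∧ φ p i' Q = 0 ∧
      (∀ j, φ q j Q ≠ 0) ∧ ∀ v, φ p i v = 0 → φ p i' v = 0 → ∃ r : ℂ, v = r • Q := by
    intro p q hpq i i' hi
    have hd := inf_dim (ln p i) (ln p i') (dim2 _ _) (dim2 _ _) (fun h => hi (hinj p h))
    obtain ⟨Q, hQ, hs⟩ := exists_gen _ hd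
    refine ⟨Q, (φ0 _ _ _).2 hQ.1, (φ0 _ _ _).2 hQ.2, fun j hj => ?_, fun v h1 h2 =>
      hs v ⟨(φ0 _ _ _).1 h1, (φ0 _ _ _).1 h2⟩⟩
    have hle : ln p i ⊓ ln p i' ≤ ln q j := fun v hv => by
      obtain ⟨r, rfl⟩ := hs v hv
      exact Submodule.smul_mem _ _ ((φ0 _ _ _).1 hj)
    have hp := pt p q i j hpq
    have e := Submodule.eq_of_le_of_finrank_eq (le_inf inf_le_left hle : _ ≤ ln p i ⊓ ln q j)
      (hd.trans (N.point_dim _ hp).symm)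
    exact hi (uniq _ hp p i i' inf_le_left (e ▸ inf_le_right))
  refine config (φ 0) (φ 1) (φ 2) (φ 3) (T 2) (T 3) (Tinj 2 (by decide)) (Tinj 3 (by decide))
    (Tinj' 2 (by decide)) (Tinj' 3 (by decide)) ?_ (comb 2 (by decide) (by decide))
    (comb 3 (by decide) (by decide)) ?_ (hQ 0 1 (by decide)) ?_
  · intro i i' j j' h h'
    have h1 := eqinf _ (hX i j) 2 3 _ _ (by decide) (hT 2 i j) (hT 3 i j)
    have h2 := eqinf _ (hX i' j') 2 3 _ _ (by decide) (hT 2 i' j') (hT 3 i' j')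
    rw [h, h', ← h2] at h1
    exact uniq _ (hX i j) 0 i i' inf_le_left (h1 ▸ inf_le_left)
  · intro i j
    obtain ⟨P, hP, hs⟩ := exists_gen _ (N.point_dim _ (hX i j))
    refine ⟨P, (φ0 _ _ _).2 hP.1, (φ0 _ _ _).2 hP.2, fun i' hi h => ?_, fun j' hj h => ?_⟩
    · refine hi (uniq _ (hX i j) 0 i' i (fun v hv => ?_) inf_le_left)
      obtain ⟨r, rfl⟩ := hs v hv
      exact Submodule.smul_mem _ _ ((φ0 _ _ _).1 h)
    · refine hj (uniq _ (hX i j) 1 j' j (fun v hv => ?_) inf_le_right)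
      obtain ⟨r, rfl⟩ := hs v hv
      exact Submodule.smul_mem _ _ ((φ0 _ _ _).1 h)
  · intro j j' h
    obtain ⟨Q, h1, h2, h3, -⟩ := hQ 1 0 (by decide) j j' h
    exact ⟨Q, h1, h2, h3⟩

end Net45


/-- There does not exist a `(4,5)`-net in `ℂℙ²`. -/
theorem no_net_4_5 :
    ¬ ∃ (A : Fin 4 → Finset (Submodule ℂ (Fin 3 → ℂ)))
        (χ : Finset (Submodule ℂ (Fin 3 → ℂ))), IsNet 4 5 A χ := by
  rintro ⟨A, χ, N⟩
  exact Net45.main A χ N
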